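/- Nonexistence of nontrivial FHR moment functions in the Gaussian linear random-coefficients model (T = 2). Let k ≥ 1 and let φ : ℝ³ × ℝ^k × ℝ^k → ℝ be measurable with (y_1, y_2) ↦ φ(y_0, y_1, y_2, x_1, x_2) Lebesgue-integrable on ℝ² for every (y_0, x_1, x_2). Suppose: (ii) for all (y_0, y_1, x_1) and all (b, c) ∈ ℝ^k × ℝ and all x_2, x̃_2 ∈ ℝ^k, ∫ φ(y_0, y_1, y_2, x_1, x_2) exp(−(y_2 − γ y_1 − b'x_2 − c)²/(2σ²)) dy_2 = ∫ φ(y_0, y_1, y_2, x_1, x̃_2) exp(−(y_2 − γ y_1 − b'x̃_2 − c)²/(2σ²)) dy_2; and (i) for all (y_0, x_1, x_2) and all (b, c) ∈ ℝ^k × ℝ, ∫∫ φ(y_0, y_1, y_2, x_1, x_2) exp(−(y_2 − γ y_1 − b'x_2 − c)²/(2σ²)) exp(−(y_1 − γ y_0 − b'x_1 − c)²/(2σ²)) dy_1 dy_2 = 0. Then for every (y_0, x_1, x_2), the function (y_1, y_2) ↦ φ(y_0, y_1, y_2, x_1, x_2) vanishes Lebesgue-almost everywhere on ℝ². -/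

import Mathlib

/-!
Nonexistence of nontrivial FHR moment functions in the Gaussian linear
random-coefficients panel model, T = 2 (Bonhomme, Dano & Graham, Section 7.1): any
integrable `φ` satisfying the FHR conditions (i) and (ii) for all values of the
multidimensional heterogeneity `(b, c)` vanishes almost everywhere in `(y_1, y_2)`.
-/

open MeasureTheory

noncomputable section

open ProbabilityTheory Filter Topology

/-- Finite measures on `ℝ` with the same moment-generating function, finite everywhere, are
equal. -/
lemma measure_ext_of_mgf_id_eq {μ ν : Measure ℝ} [IsFiniteMeasure μ] [IsFiniteMeasure ν]
    (hμ : ∀ t, Integrable (fun y => Real.exp (t * y)) μ) (h : mgf id μ = mgf id ν) : μ = ν := by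
  have h_zero : μ = 0 ↔ ν = 0 := by
    have h0 := congrFun h 0
    simp only [mgf_zero'] at h0
    rw [← Measure.measure_univ_eq_zero, ← Measure.measure_univ_eq_zero,
      ← measureReal_eq_zero_iff, ← measureReal_eq_zero_iff, h0]
  have h_univ : integrableExpSet id μ = Set.univ := Set.eq_univ_of_forall hμ
  refine Measure.ext_of_complexMGF_id_eq (funext fun z => ?_)
  exact eqOn_complexMGF_of_mgf' h h_zero (by simp [h_univ])

/-- A function on `ℝ` whose two-sided Laplace transform converges and vanishes on the whole real
line vanishes almost everywhere. -/
lemma ae_eq_zero_of_laplace_eq_zero {g : ℝ → ℝ}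
    (hg : ∀ t, Integrable fun y => g y * Real.exp (t * y))
    (h : ∀ t, ∫ y, g y * Real.exp (t * y) = 0) : ∀ᵐ y, g y = 0 := by
  have hg0 : Integrable g := by simpa using hg 0
  have hpos : AEMeasurable (fun y => ENNReal.ofReal (g y)) := hg0.aemeasurable.ennreal_ofReal
  have hneg : AEMeasurable (fun y => ENNReal.ofReal (-g y)) :=
    hg0.neg.aemeasurable.ennreal_ofReal
  have hpos_top : ∀ᵐ y : ℝ, ENNReal.ofReal (g y) < ⊤ := by simp
  have hneg_top : ∀ᵐ y : ℝ, ENNReal.ofReal (-g y) < ⊤ := by simp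
  have : IsFiniteMeasure (volume.withDensity fun y => ENNReal.ofReal (g y)) :=
    isFiniteMeasure_withDensity_ofReal hg0.2
  have : IsFiniteMeasure (volume.withDensity fun y => ENNReal.ofReal (-g y)) :=
    isFiniteMeasure_withDensity_ofReal hg0.neg.2
  have hpos_int : ∀ t, Integrable fun y => (ENNReal.ofReal (g y)).toReal * Real.exp (t * y) := by
    intro t
    refine (hg t).mono (by fun_prop) (.of_forall fun y => ?_)
    simp only [ENNReal.toReal_ofReal', norm_mul, Real.norm_eq_abs]
    refine mul_le_mul_of_nonneg_right ?_ (abs_nonneg _)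
    rw [abs_of_nonneg (le_max_right _ _)]
    exact max_le (le_abs_self _) (abs_nonneg _)
  have hneg_int : ∀ t, Integrable fun y => (ENNReal.ofReal (-g y)).toReal * Real.exp (t * y) := by
    intro t
    refine (hg t).mono (by fun_prop) (.of_forall fun y => ?_)
    simp only [ENNReal.toReal_ofReal', norm_mul, Real.norm_eq_abs]
    refine mul_le_mul_of_nonneg_right ?_ (abs_nonneg _)
    rw [abs_of_nonneg (le_max_right _ _)]
    exact max_le (neg_le_abs _) (abs_nonneg _)
  have heq : volume.withDensity (fun y => ENNReal.ofReal (g y)) =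
      volume.withDensity fun y => ENNReal.ofReal (-g y) := by
    refine measure_ext_of_mgf_id_eq (fun t => ?_) (funext fun t => ?_)
    · exact (integrable_withDensity_iff_integrable_smul₀' hpos hpos_top).2 (hpos_int t)
    · simp only [mgf, id]
      rw [integral_withDensity_eq_integral_toReal_smul₀ hpos hpos_top,
        integral_withDensity_eq_integral_toReal_smul₀ hneg hneg_top, ← sub_eq_zero]
      simp only [smul_eq_mul]
      rw [← integral_sub (hpos_int t) (hneg_int t), ← h t]
      congr with y
      rw [← sub_mul]
      simp only [ENNReal.toReal_ofReal', max_zero_sub_max_neg_zero_eq_self]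
  filter_upwards [(withDensity_eq_iff hpos hneg hg0.lintegral_lt_top.ne).1 heq] with y hy
  have hy := congrArg ENNReal.toReal hy
  simp only [ENNReal.toReal_ofReal'] at hy
  rcases le_total (g y) 0 with h0 | h0
  · rw [max_eq_right h0, max_eq_left (by linarith)] at hy
    linarith
  · rw [max_eq_left h0, max_eq_right (by linarith)] at hy
    exact hy

lemma norm_mul_exp_neg_sq_div_le (a x : ℝ) {v : ℝ} (hv : 0 < v) :
    ‖a * Real.exp (-x ^ 2 / (2 * v))‖ ≤ ‖a‖ := by
  rw [norm_mul, Real.norm_of_nonneg (Real.exp_pos _).le]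
  refine mul_le_of_le_one_right (norm_nonneg a) (Real.exp_le_one_iff.2 ?_)
  exact div_nonpos_of_nonpos_of_nonneg (by nlinarith [sq_nonneg x]) (by positivity)

/-- Convolution with a Gaussian kernel is injective on integrable functions. -/
lemma ae_eq_zero_of_gaussian_conv_eq_zero {f : ℝ → ℝ} (hf : Integrable f) {v : ℝ} (hv : 0 < v)
    (h : ∀ s, ∫ y, f y * Real.exp (-(y - s) ^ 2 / (2 * v)) = 0) : ∀ᵐ y, f y = 0 := by
  have key : ∀ t y, f y * Real.exp (-y ^ 2 / (2 * v)) * Real.exp (t * y) =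
      Real.exp (v * t ^ 2 / 2) * (f y * Real.exp (-(y - v * t) ^ 2 / (2 * v))) := by
    intro t y
    rw [mul_assoc, ← Real.exp_add, mul_left_comm, ← Real.exp_add]
    congr 2
    field_simp
    ring
  have hint : ∀ s, Integrable fun y => f y * Real.exp (-(y - s) ^ 2 / (2 * v)) := fun s =>
    hf.mono (by fun_prop) (.of_forall fun y => norm_mul_exp_neg_sq_div_le _ _ hv)
  have hzero := ae_eq_zero_of_laplace_eq_zero
    (g := fun y => f y * Real.exp (-y ^ 2 / (2 * v)))
    (fun t => by simp only [key]; exact (hint _).const_mul _)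
    (fun t => by simp only [key]; rw [integral_const_mul, h, mul_zero])
  filter_upwards [hzero] with y hy
  exact (mul_eq_zero.1 hy).resolve_right (Real.exp_ne_zero _)

/-- The convolution of an integrable function with a Gaussian kernel vanishes at infinity. -/
lemma tendsto_gaussian_conv_atTop {f : ℝ → ℝ} (hf : Integrable f) {v : ℝ} (hv : 0 < v) :
    Tendsto (fun s => ∫ y, f y * Real.exp (-(y - s) ^ 2 / (2 * v))) atTop (𝓝 0) := by
  rw [← integral_zero ℝ ℝ]
  refine tendsto_integral_filter_of_dominated_convergence (fun y => ‖f y‖)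
    (.of_forall fun s => by fun_prop)
    (.of_forall fun s => .of_forall fun y => norm_mul_exp_neg_sq_div_le _ _ hv) hf.norm
    (.of_forall fun y => ?_)
  rw [← mul_zero (f y)]
  refine (Real.tendsto_exp_atBot.comp ?_).const_mul _
  refine Tendsto.atBot_div_const (by positivity) (tendsto_neg_atTop_atBot.comp ?_)
  refine (tendsto_pow_atTop two_ne_zero).comp (tendsto_id.atTop_add tendsto_const_nhds) |>.congr
    (f₁ := fun s => (s + -y) ^ 2) fun s => ?_
  ring

/-- An integrable function whose convolution with a Gaussian kernel is constant vanishes almost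
everywhere. -/
lemma ae_eq_zero_of_gaussian_conv_eq_const {f : ℝ → ℝ} (hf : Integrable f) {v : ℝ} (hv : 0 < v)
    {K : ℝ} (h : ∀ s, ∫ y, f y * Real.exp (-(y - s) ^ 2 / (2 * v)) = K) : ∀ᵐ y, f y = 0 := by
  refine ae_eq_zero_of_gaussian_conv_eq_zero hf hv fun s => (h s).trans ?_
  have hlim := tendsto_gaussian_conv_atTop hf hv
  simp only [h] at hlim
  exact tendsto_nhds_unique tendsto_const_nhds hlim

/-- **Nonexistence of nontrivial FHR moment functions in the Gaussian linear
random-coefficients model (T = 2).** -/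
theorem gaussian_random_coefficients_no_moments
    {k : ℕ} (hk : 1 ≤ k) (γ : ℝ) (σ2 : ℝ) (hσ2 : 0 < σ2)
    (φ : ℝ → ℝ → ℝ → (Fin k → ℝ) → (Fin k → ℝ) → ℝ)
    (hφ_meas : Measurable fun p : ℝ × ℝ × ℝ × (Fin k → ℝ) × (Fin k → ℝ) =>
      φ p.1 p.2.1 p.2.2.1 p.2.2.2.1 p.2.2.2.2)
    (hφ_int : ∀ (y0 : ℝ) (x1 x2 : Fin k → ℝ),
      Integrable (fun p : ℝ × ℝ => φ y0 p.1 p.2 x1 x2) (volume : Measure (ℝ × ℝ)))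
    -- condition (ii)
    (hii : ∀ (y0 y1 : ℝ) (x1 : Fin k → ℝ) (b : Fin k → ℝ) (c : ℝ) (x2 x2' : Fin k → ℝ),
      (∫ y2, φ y0 y1 y2 x1 x2 *
          Real.exp (-(y2 - γ * y1 - (∑ i, b i * x2 i) - c) ^ 2 / (2 * σ2))) =
      (∫ y2, φ y0 y1 y2 x1 x2' *
          Real.exp (-(y2 - γ * y1 - (∑ i, b i * x2' i) - c) ^ 2 / (2 * σ2))))
    -- condition (i)
    (hi : ∀ (y0 : ℝ) (x1 x2 : Fin k → ℝ) (b : Fin k → ℝ) (c : ℝ),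
      (∫ y1, (∫ y2, φ y0 y1 y2 x1 x2 *
            Real.exp (-(y2 - γ * y1 - (∑ i, b i * x2 i) - c) ^ 2 / (2 * σ2))) *
          Real.exp (-(y1 - γ * y0 - (∑ i, b i * x1 i) - c) ^ 2 / (2 * σ2))) = 0) :
    ∀ (y0 : ℝ) (x1 x2 : Fin k → ℝ),
      ∀ᵐ p : ℝ × ℝ ∂(volume : Measure (ℝ × ℝ)), φ y0 p.1 p.2 x1 x2 = 0 := by
  intro y0 x1 x2
  have hmeas : Measurable fun p : ℝ × ℝ => φ y0 p.1 p.2 x1 x2 :=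
    hφ_meas.comp (f := fun p : ℝ × ℝ => (y0, p.1, p.2, x1, x2)) (by fun_prop)
  refine (Measure.ae_prod_iff_ae_ae (measurableSet_eq_fun hmeas measurable_const)).2 ?_
  filter_upwards [Integrable.prod_right_ae (hφ_int y0 x1 x2)] with y1 hy1
  let i0 : Fin k := ⟨0, hk⟩
  -- moving `x2` in a coordinate direction decouples the two indices `b'x2 + c`
  refine ae_eq_zero_of_gaussian_conv_eq_const hy1 hσ2
    (K := ∫ y2, φ y0 y1 y2 x1 (x2 + Pi.single i0 1) *
      Real.exp (-(y2 - γ * y1) ^ 2 / (2 * σ2))) fun s => ?_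
  have h := hii y0 y1 x1 (Pi.single i0 (γ * y1 - s)) (s - γ * y1 - (γ * y1 - s) * x2 i0) x2
    (x2 + Pi.single i0 1)
  simp only [Pi.add_apply, mul_add, Finset.sum_add_distrib, Pi.single_apply, ite_mul, zero_mul,
    Finset.sum_ite_eq', Finset.mem_univ, if_true, mul_one] at h
  convert h using 6 <;> ring

end
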